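/- Let f ∈ ℚ[x,z₁,…,zₙ] be a polynomial of total degree d in n+1 variables that is monic in x, and let δ be a positive integer. Then there exist weight vectors w = (w₁,…,wₙ) and w' = (w₁',…,wₙ') in ℕⁿ such that for every irreducible factor g of f of total degree δ, the polynomial Ψ(g) = g(x, y^{w₁}t + y^{w₁'}, …, y^{wₙ}t + y^{wₙ'}) ∈ ℚ[x,y,t] is an irreducible factor of Ψ(f) = f(x, y^{w₁}t + y^{w₁'}, …, y^{wₙ}t + y^{wₙ'}). -/

import Mathlib

namespace Polynomial

section Lifting

variable {R : Type*} [CommRing R]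

theorem C_X_dvd_iff_map_constantCoeff_eq_zero {E : R[X][X]} :
    C X ∣ E ↔ E.map constantCoeff = 0 := by
  simp [C_dvd_iff_dvd_coeff, X_dvd_iff, Polynomial.ext_iff]

theorem degree_C_X_pow_mul (k : ℕ) (E : R[X][X]) :
    (C (X ^ k) * E).degree = E.degree := by
  have h : ∀ i, (C (X ^ k) * E).coeff i = 0 ↔ E.coeff i = 0 := fun i ↦ by
    rw [coeff_C_mul, X_pow_mul, (monic_X_pow k).mul_left_eq_zero_iff]
  have hsupp : (C (X ^ k) * E).support = E.support := by
    ext i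
    simp only [mem_support_iff, ne_eq, h]
  rw [degree, degree, hsupp]

theorem exists_eq_mul_add_mul_of_isCoprime [Nontrivial R] {A B E : R[X]} (hA : A.Monic) (hB : B.Monic)
    (hAB : IsCoprime A B) (hE : E.degree < (A * B).degree) :
    ∃ P Q : R[X], E = P * B + A * Q ∧ P.degree < A.degree ∧ Q.degree < B.degree := by
  obtain ⟨U, V, h⟩ := hAB
  have h₁ := modByMonic_add_div (E * V) A
  have hP : ((E * V) %ₘ A).degree < A.degree := degree_modByMonic_lt _ hA
  have hEq : E = (E * V) %ₘ A * B + A * (U * E + (E * V) /ₘ A * B) := by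
    linear_combination (-E) * h - B * h₁
  refine ⟨_, _, hEq, hP, ?_⟩
  by_contra! hQ
  set Q := U * E + (E * V) /ₘ A * B
  have h₂ : (A * B).degree ≤ (A * Q).degree := by
    rw [mul_comm A B, mul_comm A Q, hA.degree_mul, hA.degree_mul]
    gcongr
  have h₃ : ((E * V) %ₘ A * B).degree < (A * B).degree := by
    rw [hB.degree_mul, hB.degree_mul]
    exact WithBot.add_lt_add_right (by simpa using hB.ne_zero) hP
  have h₄ : A * Q = E - (E * V) %ₘ A * B := by linear_combination -hEq
  exact absurd (h₄ ▸ (degree_sub_le _ _).trans_lt (max_lt hE h₃) : (A * Q).degree < (A * B).degree) h₂.not_gt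

theorem exists_lift_factorization {F : R[X][X]} (hF : F.Monic) {A₀ B₀ : R[X]} (hA₀ : A₀.Monic)
    (hB₀ : B₀.Monic) (hAB : IsCoprime A₀ B₀) (h : F.map constantCoeff = A₀ * B₀) (m : ℕ) :
    ∃ A B : R[X][X], A.Monic ∧ B.Monic ∧ A.map constantCoeff = A₀ ∧ B.map constantCoeff = B₀ ∧
      (∀ i, (A.coeff i).natDegree ≤ m) ∧ (∀ i, (B.coeff i).natDegree ≤ m) ∧
      C (X ^ (m + 1)) ∣ F - A * B := by
  nontriviality R
  have hcomp : (constantCoeff (R := R)).comp C = RingHom.id R := by ext; simp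
  have hdeg : F.degree = (A₀ * B₀).degree := by rw [← h, hF.degree_map]
  induction m with
  | zero =>
    refine ⟨A₀.map C, B₀.map C, hA₀.map _, hB₀.map _, ?_, ?_, ?_, ?_, ?_⟩
    · rw [map_map, hcomp, map_id]
    · rw [map_map, hcomp, map_id]
    · simp
    · simp
    · rw [zero_add, pow_one, C_X_dvd_iff_map_constantCoeff_eq_zero]
      simp [Polynomial.map_sub, Polynomial.map_mul, map_map, hcomp, h]
  | succ m ih =>
    obtain ⟨A, B, hA, hB, rfl, rfl, hAm, hBm, E, hE⟩ := ih
    have hEdeg : (E.map constantCoeff).degree <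
        (A.map constantCoeff * B.map constantCoeff).degree := by
      refine (degree_map_le).trans_lt ?_
      rw [← degree_C_X_pow_mul (m + 1), ← hE, ← hdeg]
      refine degree_sub_lt_left ?_ hF.ne_zero (by rw [hF.leadingCoeff, (hA.mul hB).leadingCoeff])
      rw [hdeg, hB.degree_mul, (hB.map _).degree_mul, hA.degree_map, hB.degree_map]
    obtain ⟨P, Q, hPQ, hP, hQ⟩ := exists_eq_mul_add_mul_of_isCoprime hA₀ hB₀ hAB hEdeg
    rw [hA.degree_map] at hP
    rw [hB.degree_map] at hQ
    have key : ∀ (D : R[X][X]) (S : R[X]), D.Monic → S.degree < D.degree →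
        (∀ i, (D.coeff i).natDegree ≤ m) →
        (D + C (X ^ (m + 1)) * S.map C).Monic ∧
        (D + C (X ^ (m + 1)) * S.map C).map constantCoeff = D.map constantCoeff ∧
        ∀ i, ((D + C (X ^ (m + 1)) * S.map C).coeff i).natDegree ≤ m + 1 := by
      intro D S hD hS hDm
      refine ⟨hD.add_of_left ?_, ?_, fun i ↦ ?_⟩
      · rw [degree_C_X_pow_mul]
        exact degree_map_le.trans_lt hS
      · simp [Polynomial.map_add, Polynomial.map_mul]
      · simp only [coeff_add, coeff_C_mul, coeff_map]
        refine natDegree_add_le_of_degree_le ((hDm i).trans (Nat.le_succ m)) ?_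
        rw [mul_comm]
        exact natDegree_C_mul_X_pow_le _ _
    obtain ⟨hA₁, hA₂, hA₃⟩ := key A P hA hP hAm
    obtain ⟨hB₁, hB₂, hB₃⟩ := key B Q hB hQ hBm
    refine ⟨_, _, hA₁, hB₁, hA₂, hB₂, hA₃, hB₃, ?_⟩
    have hdvd : C X ∣ E - P.map C * B - A * Q.map C -
        C (X ^ (m + 1)) * (P.map C * Q.map C) := by
      rw [C_X_dvd_iff_map_constantCoeff_eq_zero]
      simp [Polynomial.map_sub, Polynomial.map_mul, map_map, hcomp, hPQ]
    have hsub : F - (A + C (X ^ (m + 1)) * P.map C) * (B + C (X ^ (m + 1)) * Q.map C) =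
        C (X ^ (m + 1)) * (E - P.map C * B - A * Q.map C -
          C (X ^ (m + 1)) * (P.map C * Q.map C)) := by
      generalize (C (X ^ (m + 1)) : R[X][X]) = τ at hE ⊢
      linear_combination hE
    rw [hsub, pow_succ X (m + 1), C_mul]
    exact mul_dvd_mul_left _ hdvd

theorem lift_factorization_unique {A B A' B' : R[X][X]} (hA : A.Monic)
    (hA' : A'.Monic) (hAA : A'.map constantCoeff = A.map constantCoeff)
    (hAB : IsCoprime (A.map constantCoeff) (B.map constantCoeff)) {m : ℕ}
    (h : C (X ^ m) ∣ A * B - A' * B') {k : ℕ} (hk : k ≤ m) :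
    C (X ^ k) ∣ A - A' ∧ C (X ^ k) ∣ B - B' := by
  nontriviality R
  induction k with
  | zero => simp
  | succ k ih =>
    obtain ⟨⟨P, hP⟩, Q, hQ⟩ := ih (by omega)
    have hreg : IsLeftRegular (C (X ^ k) : R[X][X]) := by
      intro U V hUV
      have : (C (X ^ k) * (U - V)).degree = ⊥ := by
        rw [degree_eq_bot]; simpa [mul_sub, sub_eq_zero] using hUV
      rw [degree_C_X_pow_mul, degree_eq_bot, sub_eq_zero] at this
      exact this
    have hdvd : C X ∣ P * B + A' * Q := by
      have h₁ : C (X ^ (k + 1)) ∣ A * B - A' * B' := ((C : R[X] →+* R[X][X]).map_dvd (pow_dvd_pow X hk)).trans h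
      obtain ⟨W, hW⟩ := h₁
      refine ⟨W, hreg ?_⟩
      have : (C (X ^ (k + 1)) : R[X][X]) = C (X ^ k) * C X := by rw [← C_mul, pow_succ]
      rw [this] at hW
      dsimp only
      linear_combination hW - B * hP - A' * hQ
    rw [C_X_dvd_iff_map_constantCoeff_eq_zero, Polynomial.map_add, Polynomial.map_mul,
      Polynomial.map_mul, hAA] at hdvd
    have hPdeg : (P.map constantCoeff).degree < (A.map constantCoeff).degree := by
      refine degree_map_le.trans_lt ?_
      rw [← degree_C_X_pow_mul k, ← hP, hA.degree_map]
      refine degree_sub_lt_left ?_ hA.ne_zero (by rw [hA.leadingCoeff, hA'.leadingCoeff])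
      rw [← hA.degree_map constantCoeff, ← hAA, hA'.degree_map]
    have hA₀ := hA.map (constantCoeff (R := R))
    have hP₀ : P.map constantCoeff = 0 := by
      by_contra hne
      have : A.map constantCoeff ∣ P.map constantCoeff * B.map constantCoeff :=
        ⟨-Q.map constantCoeff, by linear_combination hdvd⟩
      exact hA₀.not_dvd_of_degree_lt hne hPdeg (hAB.dvd_of_dvd_mul_right this)
    have hQ₀ : Q.map constantCoeff = 0 := by
      rw [hP₀, zero_mul, zero_add] at hdvd
      exact hA₀.isRegular.left (by simpa using hdvd)
    rw [hP, hQ, pow_succ, C_mul]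
    exact ⟨mul_dvd_mul_left _ (C_X_dvd_iff_map_constantCoeff_eq_zero.2 hP₀),
      mul_dvd_mul_left _ (C_X_dvd_iff_map_constantCoeff_eq_zero.2 hQ₀)⟩

theorem coeff_coeff_swap (p : R[X][X]) (i j : ℕ) :
    ((Bivariate.swap p).coeff i).coeff j = (p.coeff j).coeff i := by
  induction p using Polynomial.induction_on' with
  | add p q hp hq => simp [hp, hq]
  | monomial n f =>
    induction f using Polynomial.induction_on' with
    | add p q hp hq => simp [hp, hq]
    | monomial m r =>
      rw [Bivariate.swap_monomial_monomial]
      simp only [coeff_monomial]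
      split_ifs <;> simp_all [coeff_monomial]

theorem natDegree_coeff_le_natDegree_swap (p : R[X][X]) (i : ℕ) :
    (p.coeff i).natDegree ≤ (Bivariate.swap p).natDegree := by
  refine natDegree_le_iff_coeff_eq_zero.2 fun N hN ↦ ?_
  rw [← coeff_coeff_swap, coeff_eq_zero_of_natDegree_lt hN, coeff_zero]

theorem natDegree_coeff_le_of_mul_eq [IsDomain R] {P Q F : R[X][X]} (hF : F ≠ 0)
    (h : P * Q = F) {e : ℕ} (he : ∀ i, (F.coeff i).natDegree ≤ e) (i : ℕ) :
    (P.coeff i).natDegree ≤ e := by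
  have h0 : Bivariate.swap P * Bivariate.swap Q ≠ 0 := by
    rw [← map_mul, h]
    simpa using hF
  refine (natDegree_coeff_le_natDegree_swap P i).trans ?_
  calc (Bivariate.swap P).natDegree
      ≤ (Bivariate.swap P * Bivariate.swap Q).natDegree := by
        rw [natDegree_mul (left_ne_zero_of_mul h0) (right_ne_zero_of_mul h0)]
        exact Nat.le_add_right _ _
    _ ≤ e := by
        rw [← map_mul, h]
        refine natDegree_le_iff_coeff_eq_zero.2 fun N hN ↦ Polynomial.ext fun j ↦ ?_
        rw [coeff_coeff_swap, coeff_eq_zero_of_natDegree_lt ((he j).trans_lt hN), coeff_zero]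

theorem finite_setOf_monic_dvd [IsDomain R] [UniqueFactorizationMonoid R] {f : R[X]}
    (hf : f ≠ 0) : {g : R[X] | g.Monic ∧ g ∣ f}.Finite := by
  have hfin : {a : Associates R[X] | a ∣ Associates.mk f}.Finite :=
    @Set.toFinite _ _ (UniqueFactorizationMonoid.fintypeSubtypeDvd (Associates.mk f)
      (Associates.mk_ne_zero.2 hf)).finite
  refine Set.Finite.of_finite_image (f := Associates.mk) (hfin.subset ?_) ?_
  · rintro _ ⟨g, ⟨-, hg⟩, rfl⟩
    exact Associates.mk_dvd_mk.2 hg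
  · rintro g ⟨hg, -⟩ g' ⟨hg', -⟩ h
    exact eq_of_monic_of_associated hg hg' (Associates.mk_eq_mk_iff_associated.1 h)

end Lifting

end Polynomial

section LineRestriction

variable {σ K : Type*} [Field K]

/-- The substitution `zⱼ ↦ aⱼ t + bⱼ`. -/
noncomputable def lineSubst (a b : σ → K) : MvPolynomial σ K →+* Polynomial K :=
  (MvPolynomial.aeval fun j ↦ Polynomial.C (a j) * Polynomial.X + Polynomial.C (b j)).toRingHom

/-- The substitution `zⱼ ↦ zⱼ t + bⱼ`. -/
noncomputable def genericLineSubst (b : σ → K) :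
    MvPolynomial σ K →+* Polynomial (MvPolynomial σ K) :=
  (MvPolynomial.aeval fun j ↦ Polynomial.C (MvPolynomial.X j) * Polynomial.X +
    Polynomial.C (MvPolynomial.C (b j))).toRingHom

theorem mapRingHom_eval_comp_genericLineSubst (a b : σ → K) :
    (Polynomial.mapRingHom (MvPolynomial.eval a)).comp (genericLineSubst b) = lineSubst a b := by
  ext i <;> simp [genericLineSubst, lineSubst, MvPolynomial.algebraMap_eq]

theorem constantCoeff_comp_lineSubst (a b : σ → K) :
    Polynomial.constantCoeff.comp (lineSubst a b) = MvPolynomial.eval b := by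
  ext i <;> simp [lineSubst]

theorem constantCoeff_comp_genericLineSubst (b : σ → K) :
    Polynomial.constantCoeff.comp (genericLineSubst b) = MvPolynomial.C.comp (MvPolynomial.eval b) := by
  ext i <;> simp [genericLineSubst, MvPolynomial.algebraMap_eq]

theorem exists_comp_genericLineSubst_eq_id (b : σ → K) :
    ∃ τ : Polynomial (MvPolynomial σ K) →+* MvPolynomial σ K,
      τ.comp (genericLineSubst b) = RingHom.id _ := by
  refine ⟨Polynomial.eval₂RingHom
    (MvPolynomial.aeval fun j ↦ MvPolynomial.X j - MvPolynomial.C (b j) :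
      MvPolynomial σ K →ₐ[K] MvPolynomial σ K).toRingHom 1, ?_⟩
  ext i <;> simp [genericLineSubst, MvPolynomial.algebraMap_eq]

open Polynomial in
theorem exists_ne_zero_forall_eval_ne_zero_no_factorization {G : (MvPolynomial σ K)[X]}
    (hG : G.Monic) (hirr : Irreducible G) (b : σ → K) {A₀ B₀ : K[X]} (hA₀ : A₀.Monic)
    (hB₀ : B₀.Monic) (hA₀d : A₀.natDegree ≠ 0) (hB₀d : B₀.natDegree ≠ 0)
    (hAB : IsCoprime A₀ B₀) (h : G.map (MvPolynomial.eval b) = A₀ * B₀) :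
    ∃ H : MvPolynomial σ K, H ≠ 0 ∧ ∀ a, MvPolynomial.eval a H ≠ 0 → ∀ P Q : K[X][X], P.Monic → Q.Monic →
      P * Q = G.map (lineSubst a b) → P.map constantCoeff ≠ A₀ := by
  set F := G.map (genericLineSubst b) with hFdef
  have hF : F.Monic := hG.map _
  obtain ⟨e, he⟩ : ∃ e, ∀ i, (F.coeff i).natDegree ≤ e :=
    ⟨_, natDegree_coeff_le_natDegree_swap F⟩
  have hF₀ : F.map constantCoeff = A₀.map MvPolynomial.C * B₀.map MvPolynomial.C := by
    rw [hFdef, map_map, constantCoeff_comp_genericLineSubst, ← map_map, h, Polynomial.map_mul]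
  obtain ⟨A, B, hA, hB, hA₁, hB₁, hAm, hBm, hdvd⟩ := exists_lift_factorization hF
    (hA₀.map MvPolynomial.C) (hB₀.map MvPolynomial.C) (hAB.map (mapRingHom MvPolynomial.C))
    hF₀ (2 * e)
  have hbig : (∃ i, e < (A.coeff i).natDegree) ∨ ∃ i, e < (B.coeff i).natDegree := by
    by_contra! hcon
    obtain ⟨hAe, hBe⟩ := hcon
    have hFAB : F = A * B := by
      rw [← sub_eq_zero]
      ext1 i
      have h₁ := (C_dvd_iff_dvd_coeff _ _).1 hdvd i
      refine eq_zero_of_dvd_of_degree_lt h₁ ?_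
      rw [degree_X_pow]
      refine (degree_le_of_natDegree_le (n := 2 * e) ?_).trans_lt
        (by exact_mod_cast Nat.lt_succ_self _)
      rw [coeff_sub]
      refine (natDegree_sub_le _ _).trans (max_le ((he i).trans (by omega)) ?_)
      rw [coeff_mul]
      refine natDegree_sum_le_of_forall_le _ _ fun x _ ↦ ?_
      rw [two_mul]
      exact natDegree_mul_le_of_le (hAe _) (hBe _)
    obtain ⟨τ, hτ⟩ := exists_comp_genericLineSubst_eq_id b
    have hGAB : A.map τ * B.map τ = G := by
      rw [← Polynomial.map_mul, ← hFAB, hFdef, map_map, hτ, map_id]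
    have hA₂ : (A.map τ).natDegree = A₀.natDegree := by
      rw [hA.natDegree_map, ← hA.natDegree_map constantCoeff, hA₁, hA₀.natDegree_map]
    have hB₂ : (B.map τ).natDegree = B₀.natDegree := by
      rw [hB.natDegree_map, ← hB.natDegree_map constantCoeff, hB₁, hB₀.natDegree_map]
    rcases (hG.irreducible_iff_natDegree.1 hirr).2 _ _ (hA.map τ) (hB.map τ) hGAB with h' | h'
    · exact hA₀d (hA₂ ▸ h')
    · exact hB₀d (hB₂ ▸ h')
  have key : ∀ a, ∀ P Q : K[X][X], P.Monic → Q.Monic →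
      P * Q = G.map (lineSubst a b) → P.map constantCoeff = A₀ →
      (∀ i k, e < k → k ≤ 2 * e → MvPolynomial.eval a ((A.coeff i).coeff k) = 0) ∧
      (∀ i k, e < k → k ≤ 2 * e → MvPolynomial.eval a ((B.coeff i).coeff k) = 0) := by
    intro a P Q hP hQ hPQ hP₀
    have hFa : F.map (mapRingHom (MvPolynomial.eval a)) = P * Q := by
      rw [hFdef, map_map, mapRingHom_eval_comp_genericLineSubst, hPQ]
    have hcc : (constantCoeff (R := K)).comp (mapRingHom (MvPolynomial.eval a)) =
        (MvPolynomial.eval a).comp constantCoeff := by ext <;> simp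
    have hid : (MvPolynomial.eval a).comp (MvPolynomial.C (σ := σ) (R := K)) = RingHom.id K := by ext; simp
    have hA₂ : (A.map (mapRingHom (MvPolynomial.eval a))).map constantCoeff = A₀ := by
      rw [map_map, hcc, ← map_map, hA₁, map_map, hid, map_id]
    have hQ₀ : Q.map constantCoeff = B₀ := by
      refine hA₀.isRegular.left ?_
      dsimp only
      rw [← h, ← hP₀, ← Polynomial.map_mul, hPQ, map_map, constantCoeff_comp_lineSubst]
    have hdvd' : C (X ^ (2 * e + 1)) ∣
        P * Q - A.map (mapRingHom (MvPolynomial.eval a)) * B.map (mapRingHom (MvPolynomial.eval a)) := by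
      have := (mapRingHom (mapRingHom (MvPolynomial.eval a))).map_dvd hdvd
      simpa [Polynomial.map_sub, Polynomial.map_mul, hFa] using this
    obtain ⟨hPA, hQB⟩ := lift_factorization_unique hP (hA.map _) (hA₂.trans hP₀.symm)
      (by rwa [hP₀, hQ₀]) hdvd' le_rfl
    have hne : G.map (lineSubst a b) ≠ 0 := (hG.map _).ne_zero
    have hGe : ∀ i, ((G.map (lineSubst a b)).coeff i).natDegree ≤ e := fun i ↦ by
      rw [← hPQ, ← hFa, coeff_map]
      exact natDegree_map_le.trans (he i)
    have main : ∀ D E : K[X][X], (∀ i, (D.coeff i).natDegree ≤ e) →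
        ∀ W : (MvPolynomial σ K)[X][X], C (X ^ (2 * e + 1)) ∣ D - W.map (mapRingHom (MvPolynomial.eval a)) →
        ∀ i k, e < k → k ≤ 2 * e → MvPolynomial.eval a ((W.coeff i).coeff k) = 0 := by
      intro D E hD W hW i k hk hk'
      have h₁ := (X_pow_dvd_iff.1 ((C_dvd_iff_dvd_coeff _ _).1 hW i)) k (by omega)
      rw [coeff_sub, coeff_sub, coeff_eq_zero_of_natDegree_lt ((hD i).trans_lt hk)] at h₁
      simpa using h₁
    exact ⟨main P Q (natDegree_coeff_le_of_mul_eq hne hPQ hGe) A hPA,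
      main Q P (natDegree_coeff_le_of_mul_eq hne ((mul_comm _ _).trans hPQ) hGe) B hQB⟩
  rcases hbig with ⟨i, hi⟩ | ⟨i, hi⟩
  · refine ⟨(A.coeff i).leadingCoeff, ?_, fun a ha P Q hP hQ hPQ hP₀ ↦
      ha ((key a P Q hP hQ hPQ hP₀).1 i _ hi (hAm i))⟩
    rw [leadingCoeff_ne_zero]
    rintro h0
    simp [h0] at hi
  · refine ⟨(B.coeff i).leadingCoeff, ?_, fun a ha P Q hP hQ hPQ hP₀ ↦
      ha ((key a P Q hP hQ hPQ hP₀).2 i _ hi (hBm i))⟩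
    rw [leadingCoeff_ne_zero]
    rintro h0
    simp [h0] at hi

open Polynomial in
/-- An effective form of Bertini's theorem: an irreducible monic polynomial stays irreducible on a
generic line through a base point at which it is separable. -/
theorem exists_ne_zero_forall_irreducible_map_lineSubst {G : (MvPolynomial σ K)[X]}
    (hG : G.Monic) (hirr : Irreducible G) (b : σ → K) (hsep : (G.map (MvPolynomial.eval b)).Separable) :
    ∃ H : MvPolynomial σ K, H ≠ 0 ∧ ∀ a, MvPolynomial.eval a H ≠ 0 → Irreducible (G.map (lineSubst a b)) := by
  have hG₀ : (G.map (MvPolynomial.eval b)).Monic := hG.map _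
  have hfin := finite_setOf_monic_dvd hG₀.ne_zero
  have hex : ∀ A₀ : K[X], ∃ H : MvPolynomial σ K, H ≠ 0 ∧ ∀ a, MvPolynomial.eval a H ≠ 0 →
      ∀ P Q : K[X][X], P.Monic → Q.Monic → P * Q = G.map (lineSubst a b) →
      P.map constantCoeff = A₀ → P.natDegree = 0 ∨ Q.natDegree = 0 := by
    intro A₀
    by_cases hA₀ : A₀.Monic ∧ A₀.natDegree ≠ 0 ∧ ∃ B₀ : K[X], B₀.Monic ∧ B₀.natDegree ≠ 0 ∧
      G.map (MvPolynomial.eval b) = A₀ * B₀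
    · obtain ⟨hA₀, hA₀d, B₀, hB₀, hB₀d, h⟩ := hA₀
      obtain ⟨H, hH, hH'⟩ := exists_ne_zero_forall_eval_ne_zero_no_factorization hG hirr b hA₀ hB₀
        hA₀d hB₀d (Separable.isCoprime (h ▸ hsep)) h
      exact ⟨H, hH, fun a ha P Q hP hQ hPQ hP₀ ↦ absurd hP₀ (hH' a ha P Q hP hQ hPQ)⟩
    · refine ⟨1, one_ne_zero, fun a _ P Q hP hQ hPQ hP₀ ↦ ?_⟩
      by_contra! hne
      subst hP₀
      refine hA₀ ⟨hP.map _, by rw [hP.natDegree_map]; exact hne.1, Q.map constantCoeff,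
        hQ.map _, by rw [hQ.natDegree_map]; exact hne.2, ?_⟩
      rw [← Polynomial.map_mul, hPQ, map_map, constantCoeff_comp_lineSubst]
  choose H hH hH' using hex
  refine ⟨∏ A₀ ∈ hfin.toFinset, H A₀, Finset.prod_ne_zero_iff.2 fun A₀ _ ↦ hH A₀,
    fun a ha ↦ ?_⟩
  rw [map_prod, Finset.prod_ne_zero_iff] at ha
  have hne : G.map (lineSubst a b) ≠ 1 := fun h1 ↦
    (hG.irreducible_iff_natDegree.1 hirr).1 <| by
      rw [← hG.natDegree_eq_zero, ← hG.natDegree_map (lineSubst a b), h1, natDegree_one]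
  refine (hG.map _).irreducible_iff_natDegree.2 ⟨hne, fun P Q hP hQ hPQ ↦ ?_⟩
  refine hH' (P.map constantCoeff) a (ha _ ?_) P Q hP hQ hPQ rfl
  rw [Set.Finite.mem_toFinset]
  refine ⟨hP.map _, Q.map constantCoeff, ?_⟩
  rw [← Polynomial.map_mul, hPQ, map_map, constantCoeff_comp_lineSubst]

open Polynomial in
theorem exists_ne_zero_forall_separable_map_eval [CharZero K] {G : (MvPolynomial σ K)[X]}
    (hG : G.Monic) (hirr : Irreducible G) :
    ∃ h : MvPolynomial σ K, h ≠ 0 ∧ ∀ b, MvPolynomial.eval b h ≠ 0 → (G.map (MvPolynomial.eval b)).Separable := by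
  let L := FractionRing (MvPolynomial σ K)
  have hL : Irreducible (G.map (algebraMap _ L)) :=
    hG.irreducible_iff_irreducible_map_fraction_map.1 hirr
  have := charZero_of_injective_algebraMap (algebraMap K L).injective
  obtain ⟨U, V, hUV⟩ := hL.separable
  obtain ⟨c, hc, hcU⟩ := IsLocalization.integerNormalization_spec
    (nonZeroDivisors (MvPolynomial σ K)) U
  obtain ⟨d, hd, hdV⟩ := IsLocalization.integerNormalization_spec
    (nonZeroDivisors (MvPolynomial σ K)) V
  set U' := IsLocalization.integerNormalization (nonZeroDivisors (MvPolynomial σ K)) U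
  set V' := IsLocalization.integerNormalization (nonZeroDivisors (MvPolynomial σ K)) V
  have hbez : C d * U' * G + C c * V' * derivative G = C (c * d) := by
    apply map_injective _ (IsFractionRing.injective (MvPolynomial σ K) L)
    rw [derivative_map] at hUV
    simp only [Polynomial.map_add, Polynomial.map_mul, map_C, hcU, hdV, map_mul]
    rw [← algebraMap_smul L c U, ← algebraMap_smul L d V, smul_eq_C_mul, smul_eq_C_mul]
    linear_combination C (algebraMap _ L c) * C (algebraMap _ L d) * hUV
  refine ⟨c * d, mul_ne_zero (nonZeroDivisors.ne_zero hc) (nonZeroDivisors.ne_zero hd),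
    fun b hb ↦ ?_⟩
  have hb' : C (MvPolynomial.eval b (c * d))⁻¹ * C (MvPolynomial.eval b (c * d)) = 1 := by
    rw [← C_mul, inv_mul_cancel₀ hb, C_1]
  have := congr_arg (Polynomial.map (MvPolynomial.eval b)) hbez
  simp only [Polynomial.map_add, Polynomial.map_mul, map_C, ← derivative_map] at this
  have hsep : C (MvPolynomial.eval b (c * d))⁻¹ * (C (MvPolynomial.eval b d) *
      U'.map (MvPolynomial.eval b)) * G.map (MvPolynomial.eval b) +
      C (MvPolynomial.eval b (c * d))⁻¹ * (C (MvPolynomial.eval b c) *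
      V'.map (MvPolynomial.eval b)) * derivative (G.map (MvPolynomial.eval b)) = 1 := by
    linear_combination hb' + C (MvPolynomial.eval b (c * d))⁻¹ * this
  exact ⟨_, _, hsep⟩

end LineRestriction

section

open Polynomial

theorem irreducible_map_algebraMap_fractionRing {σ k : Type*} [Field k]
    {g : (MvPolynomial σ k)[X]} (hg : g.Monic) (hirr : Irreducible g) :
    Irreducible (g.map (MvPolynomial.map (algebraMap k (FractionRing k[X])))) := by
  let S := (MvPolynomial σ k)[X]
  let L := FractionRing S
  have hS : Irreducible (g.map (C : MvPolynomial σ k →+* S)) := by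
    refine (hg.map _).irreducible_of_irreducible_map (constantCoeff : S →+* MvPolynomial σ k) _ ?_
    have : constantCoeff.comp (C : MvPolynomial σ k →+* S) = RingHom.id _ := by ext <;> simp
    rwa [map_map, this, map_id]
  have hL := ((hg.map _).irreducible_iff_irreducible_map_fraction_map (K := L)).1 hS
  have hinj : Function.Injective (mapRingHom (MvPolynomial.C (σ := σ) (R := k))) :=
    map_injective _ (MvPolynomial.C_injective σ k)
  let κ : FractionRing k[X] →+* L := IsFractionRing.map hinj
  let ψ : MvPolynomial σ (FractionRing k[X]) →+* L :=
    MvPolynomial.eval₂Hom κ fun j ↦ algebraMap S L (C (MvPolynomial.X j))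
  have hψ : ψ.comp (MvPolynomial.map (algebraMap k (FractionRing k[X]))) =
      (algebraMap S L).comp C := by
    ext r
    · have : κ (algebraMap k[X] _ (C r)) = algebraMap S L (mapRingHom MvPolynomial.C (C r)) :=
        IsLocalization.map_eq _ _
      simpa [ψ, IsScalarTower.algebraMap_apply k k[X] (FractionRing k[X])] using this
    · simp [ψ]
  refine (hg.map _).irreducible_of_irreducible_map ψ _ ?_
  rwa [map_map, hψ, ← map_map]

end

theorem exists_forall_eval_pow_ne_zero {σ ι K : Type*} [CommRing K] [IsDomain K] {y : K}
    (hy : Function.Injective fun k : ℕ ↦ y ^ k) (s : Finset ι) (H : ι → MvPolynomial σ K)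
    (hH : ∀ i ∈ s, H i ≠ 0) :
    ∃ w : σ → ℕ, ∀ i ∈ s, MvPolynomial.eval (fun j ↦ y ^ w j) (H i) ≠ 0 := by
  by_contra! hcon
  refine Finset.prod_ne_zero_iff.2 hH
    (MvPolynomial.funext_set (fun _ ↦ Set.range fun k : ℕ ↦ y ^ k)
      (fun _ ↦ Set.infinite_range_of_injective hy) fun x hx ↦ ?_)
  choose w hw using fun j ↦ hx j (Set.mem_univ j)
  obtain rfl : (fun j ↦ y ^ w j) = x := funext hw
  obtain ⟨i, hi, h0⟩ := hcon w
  rw [map_prod, map_zero]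
  exact Finset.prod_eq_zero hi h0

open Polynomial in
theorem exists_weights_forall_irreducible_map {σ k : Type*} [Field k] [CharZero k]
    (s : Finset (MvPolynomial σ k)[X]) (hs : ∀ G ∈ s, G.Monic ∧ Irreducible G) :
    ∃ w w' : σ → ℕ, ∀ G ∈ s, Irreducible (G.map (MvPolynomial.aeval fun j ↦
      MvPolynomial.X 0 ^ w j * MvPolynomial.X 1 + MvPolynomial.X 0 ^ w' j :
      MvPolynomial σ k →ₐ[k] MvPolynomial (Fin 2) k).toRingHom) := by
  let K := FractionRing k[X]
  have : CharZero K := charZero_of_injective_algebraMap (algebraMap k K).injective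
  let y : K := algebraMap k[X] K X
  have hy : Function.Injective fun m : ℕ ↦ y ^ m := fun m m' h ↦ by
    have h' : (X ^ m : k[X]) = X ^ m' := IsFractionRing.injective k[X] K (by simpa [y] using h)
    simpa using congr_arg natDegree h'
  let φ : MvPolynomial σ k →+* MvPolynomial σ K := MvPolynomial.map (algebraMap k K)
  have hK : ∀ G ∈ s, (G.map φ).Monic ∧ Irreducible (G.map φ) := fun G hG ↦
    ⟨(hs G hG).1.map _, irreducible_map_algebraMap_fractionRing (hs G hG).1 (hs G hG).2⟩
  choose! h hh hsep using fun G hG ↦ exists_ne_zero_forall_separable_map_eval (hK G hG).1 (hK G hG).2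
  obtain ⟨w', hw'⟩ := exists_forall_eval_pow_ne_zero hy s h hh
  choose! H hH hirr using fun G hG ↦ exists_ne_zero_forall_irreducible_map_lineSubst
    (hK G hG).1 (hK G hG).2 _ (hsep G hG _ (hw' G hG))
  obtain ⟨w, hw⟩ := exists_forall_eval_pow_ne_zero hy s H hH
  refine ⟨w, w', fun G hG ↦ ?_⟩
  refine ((hs G hG).1.map _).irreducible_of_irreducible_map
    (MvPolynomial.eval₂Hom (algebraMap k K[X]) ![C y, X]) _ ?_
  have hG' := hirr G hG _ (hw G hG)
  rw [map_map] at hG' ⊢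
  have hcomp : (MvPolynomial.eval₂Hom (algebraMap k K[X]) ![C y, X]).comp
      (MvPolynomial.aeval fun j ↦ MvPolynomial.X 0 ^ w j * MvPolynomial.X 1 +
        MvPolynomial.X 0 ^ w' j :
        MvPolynomial σ k →ₐ[k] MvPolynomial (Fin 2) k).toRingHom =
      (lineSubst (fun j ↦ y ^ w j) fun j ↦ y ^ w' j).comp φ := by
    ext i <;> simp [φ, lineSubst, IsScalarTower.algebraMap_apply k K K[X]]
  rwa [hcomp]

open Polynomial in
theorem exists_monic_associated_of_dvd_monic {R : Type*} [CommRing R] [IsDomain R] {f g : R[X]}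
    (hf : f.Monic) (hg : g ∣ f) : ∃ G : R[X], G.Monic ∧ Associated g G := by
  have hu := hf.isUnit_leadingCoeff_of_dvd hg
  refine ⟨_, monic_of_isUnit_leadingCoeff_inv_smul hu, ?_⟩
  rw [Units.smul_def, smul_eq_C_mul]
  exact (associated_unit_mul_left g _ (isUnit_C.2 (Units.isUnit _))).symm

/-- Let `f ∈ ℚ[x,z₁,…,zₙ]` (modelled as `MvPolynomial (Option (Fin n)) ℚ`
with `x = X none`) be of total degree `d` and monic in `x`, and let `δ > 0`.  Then
there exist weight vectors `w, w' ∈ ℕⁿ` such that for every irreducible factor `g`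
of `f` of total degree `δ`, the polynomial
`Ψ(g) = g(x, y^{w₁}t + y^{w₁'}, …, y^{wₙ}t + y^{wₙ'}) ∈ ℚ[x,y,t]`
is an irreducible factor of `Ψ(f)` (with `ℚ[x,y,t]` modelled as
`MvPolynomial (Fin 3) ℚ`, `x = X 0`, `y = X 1`, `t = X 2`). -/
theorem stmt11 (n d δ : ℕ) (hδ : 0 < δ) (f : MvPolynomial (Option (Fin n)) ℚ)
    (hdeg : f.totalDegree = d)
    (hmonic : (MvPolynomial.optionEquivLeft ℚ (Fin n) f).Monic) :
    ∃ w w' : Fin n → ℕ,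
      ∀ g : MvPolynomial (Option (Fin n)) ℚ,
        Irreducible g → g ∣ f → g.totalDegree = δ →
          Irreducible (MvPolynomial.aeval
              (fun i : Option (Fin n) => i.elim (MvPolynomial.X 0)
                (fun j => MvPolynomial.X 1 ^ w j * MvPolynomial.X 2 + MvPolynomial.X 1 ^ w' j) :
                Option (Fin n) → MvPolynomial (Fin 3) ℚ) g) ∧
          (MvPolynomial.aeval
              (fun i : Option (Fin n) => i.elim (MvPolynomial.X 0)
                (fun j => MvPolynomial.X 1 ^ w j * MvPolynomial.X 2 + MvPolynomial.X 1 ^ w' j) :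
                Option (Fin n) → MvPolynomial (Fin 3) ℚ) g) ∣
            (MvPolynomial.aeval
              (fun i : Option (Fin n) => i.elim (MvPolynomial.X 0)
                (fun j => MvPolynomial.X 1 ^ w j * MvPolynomial.X 2 + MvPolynomial.X 1 ^ w' j) :
                Option (Fin n) → MvPolynomial (Fin 3) ℚ) f) := by
  classical
  have hfin := Polynomial.finite_setOf_monic_dvd hmonic.ne_zero
  obtain ⟨w, w', hw⟩ := exists_weights_forall_irreducible_map
    (hfin.toFinset.filter Irreducible) (by simp +contextual)
  refine ⟨w, w', fun g hg hgf _ ↦ ⟨?_, map_dvd _ hgf⟩⟩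
  set e := MvPolynomial.optionEquivLeft ℚ (Fin n)
  obtain ⟨G, hG, hgG⟩ := exists_monic_associated_of_dvd_monic hmonic (map_dvd e hgf)
  have hGirr : Irreducible G := hgG.irreducible ((MulEquiv.irreducible_iff e).2 hg)
  have hirr := hw G (by
    simpa [hG, hGirr] using hgG.dvd_iff_dvd_left.1 (map_dvd e hgf))
  rw [← MulEquiv.irreducible_iff (MvPolynomial.finSuccEquiv ℚ 2)]
  refine Associated.irreducible (Associated.symm ?_) hirr
  have hmap := hgG.map (Polynomial.mapRingHom (MvPolynomial.aeval fun j ↦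
    MvPolynomial.X 0 ^ w j * MvPolynomial.X 1 + MvPolynomial.X 0 ^ w' j :
    MvPolynomial (Fin n) ℚ →ₐ[ℚ] MvPolynomial (Fin 2) ℚ).toRingHom)
  rw [Polynomial.coe_mapRingHom] at hmap
  convert hmap using 1
  suffices h : ((MvPolynomial.finSuccEquiv ℚ 2).toAlgHom.comp (MvPolynomial.aeval
      (fun i : Option (Fin n) => i.elim (MvPolynomial.X 0)
        (fun j => MvPolynomial.X 1 ^ w j * MvPolynomial.X 2 + MvPolynomial.X 1 ^ w' j) :
        Option (Fin n) → MvPolynomial (Fin 3) ℚ))) =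
      (Polynomial.mapAlgHom (MvPolynomial.aeval fun j ↦
        MvPolynomial.X 0 ^ w j * MvPolynomial.X 1 + MvPolynomial.X 0 ^ w' j)).comp
        e.toAlgHom from DFunLike.congr_fun h g
  have h₁ : MvPolynomial.finSuccEquiv ℚ 2 (MvPolynomial.X 1) =
      Polynomial.C (MvPolynomial.X 0) := MvPolynomial.finSuccEquiv_X_succ (j := 0)
  have h₂ : MvPolynomial.finSuccEquiv ℚ 2 (MvPolynomial.X 2) =
      Polynomial.C (MvPolynomial.X 1) := MvPolynomial.finSuccEquiv_X_succ (j := 1)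
  refine MvPolynomial.algHom_ext fun i ↦ ?_
  cases i <;> simp [e, h₁, h₂, MvPolynomial.optionEquivLeft_X_none,
    MvPolynomial.optionEquivLeft_X_some, MvPolynomial.finSuccEquiv_X_zero]
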